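/- Let g : K → K be a Gold function g(x) = x^{2^r+1} with gcd(r, 2k) = 1, and let f = f_{c,s} be an APN function in the family (with k, s odd and coprime, b a generator of K^*, c ∈ K ∖ L). If f and g are EA-equivalent, then the associated codes are equal: C_f = C_g. -/

import Mathlib

/-- The code `C_f` associated to a function `f : K → K`. -/
def code {K : Type*} [Field K] [Algebra (ZMod 2) K] (f : K → K) : Set (K → ZMod 2) :=
  {c | ∃ (α β : K) (ε : ZMod 2),
    c = fun x => Algebra.trace (ZMod 2) K (α * x) + Algebra.trace (ZMod 2) K (β * f x) + ε}

/-- The trinomial family `f_{c,s}(x) = b x^(2^s+1) + (b x^(2^s+1))^(2^k) + c x^(2^k+1)`. -/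
def fam {K : Type*} [Field K] (k s : ℕ) (b c : K) : K → K :=
  fun x => b * x ^ (2 ^ s + 1) + (b * x ^ (2 ^ s + 1)) ^ (2 ^ k) + c * x ^ (2 ^ k + 1)

/-- `f` is APN. -/
def IsAPN {K : Type*} [Field K] (f : K → K) : Prop :=
  ∀ a b : K, a ≠ 0 → ({x : K | f (x + a) + f x = b}).ncard ≤ 2

/-- An affine map `K → K`. -/
def IsAffineMap {K : Type*} [Field K] [Algebra (ZMod 2) K] (A : K → K) : Prop :=
  ∃ (L : K →ₗ[ZMod 2] K) (t : K), ∀ x, A x = L x + t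

/-- EA-equivalence of functions `K → K`. -/
def EAEquiv {K : Type*} [Field K] [Algebra (ZMod 2) K] (f g : K → K) : Prop :=
  ∃ A₁ A₂ A : K → K, IsAffineMap A₁ ∧ Function.Bijective A₁ ∧
    IsAffineMap A₂ ∧ Function.Bijective A₂ ∧ IsAffineMap A ∧
    ∀ x, g x = A₁ (f (A₂ x)) + A x

section GaloisSums

variable {F K : Type*} [Field F] [Field K] [Algebra F K]

theorem linearIndependent_gal : LinearIndependent K (fun σ : Gal(K/F) => (σ : K →ₗ[F] K)) :=
  (linearIndependent_toLinearMap F K K).comp (fun σ : Gal(K/F) => (σ : K →ₐ[F] K))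
    fun _ _ h => AlgEquiv.ext fun x => DFunLike.congr_fun h x

variable [FiniteDimensional F K]

theorem eq_zero_of_gal_sum_eq_zero (a : Gal(K/F) → K)
    (h : ∀ x, ∑ σ, a σ * σ x = 0) (σ : Gal(K/F)) : a σ = 0 := by
  have hli := Fintype.linearIndependent_iff.1 (linearIndependent_gal (F := F) (K := K))
  refine hli a (LinearMap.ext fun x => ?_) σ
  simpa using h x

theorem eq_zero_of_gal_sum_sum_eq_zero (C : Gal(K/F) → Gal(K/F) → K)
    (h : ∀ x y, ∑ σ, ∑ ρ, C σ ρ * σ x * ρ y = 0) (σ ρ : Gal(K/F)) : C σ ρ = 0 := by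
  refine eq_zero_of_gal_sum_eq_zero (fun ρ => C σ ρ) (fun y => ?_) ρ
  refine eq_zero_of_gal_sum_eq_zero (fun σ => ∑ ρ, C σ ρ * ρ y) (fun x => ?_) σ
  rw [← h x y]
  refine Finset.sum_congr rfl fun σ _ => ?_
  rw [Finset.sum_mul]
  exact Finset.sum_congr rfl fun ρ _ => by ring

theorem exists_eq_gal_sum [IsGalois F K] (L : K →ₗ[F] K) :
    ∃ a : Gal(K/F) → K, ∀ x, L x = ∑ σ, a σ * σ x := by
  have hspan : Submodule.span K (Set.range fun σ : Gal(K/F) => (σ : K →ₗ[F] K)) = ⊤ := by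
    refine linearIndependent_gal.span_eq_top_of_card_eq_finrank' ?_
    rw [Module.finrank_linearMap_self, ← Nat.card_eq_fintype_card, IsGalois.card_aut_eq_finrank]
  obtain ⟨a, ha⟩ := (Submodule.mem_span_range_iff_exists_fun K).1
    (hspan ▸ Submodule.mem_top : L ∈ Submodule.span K (Set.range fun σ : Gal(K/F) => (σ : K →ₗ[F] K)))
  exact ⟨a, fun x => by rw [← ha]; simp⟩

/-- In characteristic two, the forms `P (x * τ y + τ x * y)` attached to `τ` contain no form
equivalent to `x * σ y + σ x * y` for a central involution `σ` outside `{τ, τ ^ 2}`. -/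
theorem not_forall_gold_eq_hermitian [CharP K 2] [IsGalois F K] (σ τ : Gal(K/F))
    (hcomm : ∀ ρ, σ * ρ = ρ * σ) (hσ : σ * σ = 1) (hσ1 : σ ≠ 1) (hστ : σ ≠ τ)
    (hστ2 : σ ≠ τ * τ) (L P : K →ₗ[F] K) (hL : Function.Surjective L) :
    ¬ ∀ x y, P (x * τ y + τ x * y) = L x * σ (L y) + σ (L x) * L y := by
  classical
  intro h
  obtain ⟨a, ha⟩ := exists_eq_gal_sum L
  obtain ⟨p, hp⟩ := exists_eq_gal_sum P
  set A : Gal(K/F) → K := fun ρ => σ (a (σ * ρ)) with hA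
  have hLσ (x : K) : σ (L x) = ∑ ρ, A ρ * ρ x := by
    rw [ha, map_sum]
    refine Fintype.sum_equiv (Equiv.mulLeft σ) _ _ fun ρ => ?_
    simp [hA, ← mul_assoc, hσ]
  have hAσ (ρ) : A (σ * ρ) = σ (a ρ) := by simp [hA, ← mul_assoc, hσ]
  have hσσ (z : K) : σ (σ z) = z := by rw [← AlgEquiv.mul_apply, hσ]; rfl
  have hcoef (α β : Gal(K/F)) : a α * A β + A α * a β =
      (if β = α * τ then p α else 0) + (if α = β * τ then p β else 0) := by
    rw [← sub_eq_zero]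
    refine eq_zero_of_gal_sum_sum_eq_zero (fun α β => a α * A β + A α * a β -
      ((if β = α * τ then p α else 0) + (if α = β * τ then p β else 0))) (fun x y => ?_) α β
    have h1 : ∑ α, ∑ β, (a α * A β + A α * a β) * α x * β y
        = L x * σ (L y) + σ (L x) * L y := by
      rw [hLσ, hLσ, ha, ha, Finset.sum_mul_sum, Finset.sum_mul_sum, ← Finset.sum_add_distrib]
      refine Finset.sum_congr rfl fun α _ => ?_
      rw [← Finset.sum_add_distrib]
      exact Finset.sum_congr rfl fun β _ => by ring
    have h2 : ∑ α, ∑ β, ((if β = α * τ then p α else 0) + (if α = β * τ then p β else 0))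
        * α x * β y = P (x * τ y + τ x * y) := by
      simp_rw [add_mul, Finset.sum_add_distrib]
      rw [hp]
      simp_rw [map_add, map_mul, mul_add, Finset.sum_add_distrib]
      congr 1
      · refine Finset.sum_congr rfl fun α _ => ?_
        simp [ite_mul, mul_assoc]
      · rw [Finset.sum_comm]
        refine Finset.sum_congr rfl fun α _ => ?_
        simp [ite_mul, mul_assoc]
    simp_rw [sub_mul, Finset.sum_sub_distrib]
    rw [h1, h2, h, sub_self]
  have hzero (α β : Gal(K/F)) (h1 : β ≠ α * τ) (h2 : α ≠ β * τ) :
      a α * A β + A α * a β = 0 := by rw [hcoef, if_neg h1, if_neg h2, add_zero]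
  have hadj (ρ : Gal(K/F)) : a ρ * A (ρ * τ) + A ρ * a (ρ * τ) = 0 := by
    by_contra hne
    have e1 := hzero ρ (σ * ρ)
      (fun e => hστ (mul_left_cancel ((hcomm ρ).symm.trans e)))
      (fun e => hστ (by
        rw [hcomm, mul_assoc] at e
        have e' : σ * τ = 1 := (mul_eq_left.1 e.symm)
        exact mul_left_cancel (hσ.trans e'.symm)))
    have e2 := hzero (ρ * τ) (σ * ρ)
      (fun e => hστ2 (mul_left_cancel (a := ρ) (by rw [← hcomm, e, mul_assoc])))
      (fun e => hσ1 (by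
        rw [mul_assoc] at e
        exact mul_eq_right.1 e.symm))
    have hs1 : a (σ * ρ) = 0 := by
      refine (mul_eq_zero.1 ?_).resolve_left hne
      linear_combination (a (ρ * τ)) * e1 + (a ρ) * e2 -
        (a ρ * a (ρ * τ) * A (σ * ρ)) * CharTwo.two_eq_zero (R := K)
    have hs2 : A (σ * ρ) = 0 := by
      refine (mul_eq_zero.1 ?_).resolve_left hne
      linear_combination (A (ρ * τ)) * e1 + (A ρ) * e2 -
        (A ρ * A (ρ * τ) * a (σ * ρ)) * CharTwo.two_eq_zero (R := K)
    refine hne ?_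
    have h3 : a ρ = 0 := by rw [hAσ] at hs2; simpa using hs2
    have h4 : A ρ = 0 := by simp [hA, hs1]
    rw [h3, h4]; ring
  have hall (α β : Gal(K/F)) : a α * A β + A α * a β = 0 := by
    by_cases h1 : β = α * τ
    · rw [h1, hadj]
    by_cases h2 : α = β * τ
    · rw [h2, ← hadj β]; ring
    exact hzero α β h1 h2
  have hLL (x y : K) : L x * σ (L y) + σ (L x) * L y = 0 := by
    rw [hLσ, hLσ, ha, ha, Finset.sum_mul_sum, Finset.sum_mul_sum, ← Finset.sum_add_distrib]
    refine Finset.sum_eq_zero fun α _ => ?_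
    rw [← Finset.sum_add_distrib]
    refine Finset.sum_eq_zero fun β _ => ?_
    linear_combination (α x * β y) * hall α β
  obtain ⟨y, hy⟩ := hL 1
  refine hσ1 (AlgEquiv.ext fun z => ?_)
  obtain ⟨x, rfl⟩ := hL z
  have := hLL x y
  rw [hy, map_one, mul_one, mul_one] at this
  exact (CharTwo.add_eq_zero.1 this).symm

end GaloisSums

theorem code_smul {K : Type*} [Field K] [Algebra (ZMod 2) K] (f : K → K) {d : K} (hd : d ≠ 0) :
    code (fun x => d * f x) = code f := by
  ext w
  constructor
  · rintro ⟨α, β, ε, rfl⟩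
    exact ⟨α, β * d, ε, by simp only [mul_assoc]⟩
  · rintro ⟨α, β, ε, rfl⟩
    exact ⟨α, β * d⁻¹, ε, by simp only [mul_assoc, inv_mul_cancel_left₀ hd]⟩

theorem pow_two_pow_of_odd {K : Type*} [Field K] (hq : ∀ x : K, x ^ 4 = x) {s : ℕ} (hs : Odd s) (x : K) :
    x ^ 2 ^ s = x ^ 2 := by
  obtain ⟨m, rfl⟩ := hs
  induction m with
  | zero => simp
  | succ m ih =>
    rw [show 2 ^ (2 * (m + 1) + 1) = 2 ^ (2 * m + 1) * 4 by ring, pow_mul, hq, ih]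

theorem fam_eq_of_card_eq_four {K : Type*} [Field K] [Fintype K] (hcard : Fintype.card K = 4)
    {s : ℕ} (hs : Odd s) (b c : K) : fam 1 s b c = fun x => (b + b ^ 2 + c) * x ^ 3 := by
  have hq (x : K) : x ^ 4 = x := hcard ▸ FiniteField.pow_card x
  funext x
  have h2 : x ^ (2 ^ s + 1) = x ^ 3 := by
    rw [pow_succ x (2 ^ s), pow_two_pow_of_odd hq hs]; ring
  simp only [fam, h2]
  linear_combination (b ^ 2 * x ^ 2) * hq x

section FiniteField

variable {K : Type*} [Field K] [Fintype K] [Algebra (ZMod 2) K]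

theorem frobenius_gal_pow_apply (m : ℕ) (x : K) :
    (FiniteField.frobeniusAlgEquivOfAlgebraic (ZMod 2) K ^ m) x = x ^ 2 ^ m := by
  rw [AlgEquiv.coe_pow, FiniteField.coe_frobeniusAlgEquivOfAlgebraic_iterate, ZMod.card]

theorem orderOf_frobenius_gal {n : ℕ} (hcard : Fintype.card K = 2 ^ n) :
    orderOf (FiniteField.frobeniusAlgEquivOfAlgebraic (ZMod 2) K) = n := by
  rw [FiniteField.orderOf_frobeniusAlgEquivOfAlgebraic]
  have h := Module.card_eq_pow_finrank (K := ZMod 2) (V := K)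
  rw [ZMod.card, hcard] at h
  exact (Nat.pow_right_injective le_rfl h).symm

theorem not_eaEquiv_fam_gold [CharP K 2] {k s r : ℕ} (hk : Odd k) (hk1 : k ≠ 1)
    (hcard : Fintype.card K = 2 ^ (2 * k)) {b c : K} (hc : c ^ (2 ^ k) ≠ c)
    (hr : Nat.gcd r (2 * k) = 1) :
    ¬ EAEquiv (fam k s b c) (fun x => x ^ (2 ^ r + 1)) := by
  rintro ⟨A₁, A₂, A, ⟨M, t₁, hM⟩, hA₁, ⟨L, t₂, hL⟩, hA₂, ⟨N, t₃, hN⟩, h⟩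
  have hMbij : Function.Bijective M := by
    have e : ⇑M = (fun x => x - t₁) ∘ A₁ := by funext x; simp [hM]
    rw [e]
    exact (Equiv.subRight t₁).bijective.comp hA₁
  have hLsurj : Function.Surjective L := by
    have e : ⇑L = (fun x => x - t₂) ∘ A₂ := by funext x; simp [hL]
    rw [e]
    exact ((Equiv.subRight t₂).bijective.comp hA₂).surjective
  set φ := FiniteField.frobeniusAlgEquivOfAlgebraic (ZMod 2) K with hφ
  have hord : orderOf φ = 2 * k := orderOf_frobenius_gal hcard
  have hφpow (m : ℕ) (x : K) : (φ ^ m) x = x ^ 2 ^ m := frobenius_gal_pow_apply m x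
  have hσ : φ ^ k * φ ^ k = 1 := by
    rw [← pow_add, ← two_mul, ← hord, pow_orderOf_eq_one]
  have hσσ (z : K) : (φ ^ k) ((φ ^ k) z) = z := by
    rw [← AlgEquiv.mul_apply, hσ, AlgEquiv.one_apply]
  have hkpos : 0 < k := hk.pos
  have hcomm (ρ : Gal(K/ZMod 2)) : φ ^ k * ρ = ρ * φ ^ k := by
    obtain ⟨m, rfl⟩ := (FiniteField.bijective_frobeniusAlgEquivOfAlgebraic_pow (ZMod 2) K).2 ρ
    exact (Commute.refl φ).pow_pow _ _
  have hσ1 : φ ^ k ≠ 1 := by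
    intro e
    have := Nat.le_of_dvd hkpos (hord ▸ orderOf_dvd_of_pow_eq_one e)
    omega
  have hστ : φ ^ k ≠ φ ^ r := by
    intro e
    rw [pow_eq_pow_iff_modEq, hord] at e
    have hkr : k ∣ r := (Nat.modEq_zero_iff_dvd.1
      ((e.of_mul_left 2).symm.trans (Nat.modEq_zero_iff_dvd.2 dvd_rfl)))
    exact hk1 (Nat.dvd_one.1 (hr ▸ Nat.dvd_gcd hkr (dvd_mul_left k 2)))
  have hστ2 : φ ^ k ≠ φ ^ r * φ ^ r := by
    intro e
    rw [← pow_add, pow_eq_pow_iff_modEq, hord] at e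
    have e2 : k % 2 = (r + r) % 2 := e.of_mul_right k
    have := Nat.odd_iff.1 hk
    omega
  have hd : c + (φ ^ k) c ≠ 0 := by
    intro e
    rw [CharTwo.add_eq_zero, hφpow] at e
    exact hc e.symm
  let E := LinearEquiv.ofBijective M hMbij
  let P : K →ₗ[ZMod 2] K := LinearMap.mulLeft (ZMod 2) (c + (φ ^ k) c)⁻¹ ∘ₗ
    (LinearMap.id + (φ ^ k).toLinearMap) ∘ₗ E.symm.toLinearMap
  refine not_forall_gold_eq_hermitian (φ ^ k) (φ ^ r) hcomm hσ hσ1 hστ hστ2 L P hLsurj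
    fun x y => ?_
  have h2 : (2 : K) = 0 := CharTwo.two_eq_zero
  set u := L x with hu
  set v := L y with hv
  set w := b * ((φ ^ s) u * v + u * (φ ^ s) v) with hw
  have hB : M (w + (φ ^ k) w + c * ((φ ^ k) u * v + u * (φ ^ k) v)) =
      x * (φ ^ r) y + (φ ^ r) x * y := by
    have hf (z : K) : fam k s b c z =
        b * ((φ ^ s) z * z) + (φ ^ k) (b * ((φ ^ s) z * z)) + c * ((φ ^ k) z * z) := by
      simp only [fam, hφpow, pow_succ]
    have hfam : w + (φ ^ k) w + c * ((φ ^ k) u * v + u * (φ ^ k) v) =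
        fam k s b c (u + v + t₂) + fam k s b c (u + t₂) + fam k s b c (v + t₂)
          + fam k s b c t₂ := by
      simp only [hf, hw, map_add, map_mul]
      ring_nf
      simp only [h2, mul_zero, add_zero]
      grind
    have hg (z : K) : M (fam k s b c (L z + t₂)) = (φ ^ r) z * z + N z + t₁ + t₃ := by
      have := h z
      simp only [hM, hL, hN] at this
      rw [hφpow, ← pow_succ]
      linear_combination -this - (N z + t₁ + t₃) * h2
    have hxy := hg (x + y)
    have h0 := hg 0
    simp only [map_add, map_zero, zero_add] at hxy h0
    rw [hfam, map_add, map_add, map_add, hu, hv, hxy, hg, hg, h0]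
    linear_combination ((φ ^ r) x * x + (φ ^ r) y * y + N x + N y + 2 * t₁ + 2 * t₃) * h2
  have hE : E.symm (x * (φ ^ r) y + (φ ^ r) x * y) =
      w + (φ ^ k) w + c * ((φ ^ k) u * v + u * (φ ^ k) v) := by
    rw [LinearEquiv.symm_apply_eq, ← hB]; rfl
  have hP : P (x * (φ ^ r) y + (φ ^ r) x * y) =
      (c + (φ ^ k) c)⁻¹ * (E.symm (x * (φ ^ r) y + (φ ^ r) x * y)
        + (φ ^ k) (E.symm (x * (φ ^ r) y + (φ ^ r) x * y))) := rfl
  rw [hP, hE, inv_mul_eq_iff_eq_mul₀ hd]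
  simp only [map_add, map_mul, hσσ]
  linear_combination (w + (φ ^ k) w) * h2

end FiniteField

/-- If the APN function `f = f_{c,s}` of the trinomial family is EA-equivalent to a Gold
function `g(x) = x^(2^r+1)` (with `gcd(r, 2k) = 1`), then the associated codes are
equal: `C_f = C_g`. -/
theorem stmt17 {K : Type*} [Field K] [Fintype K] [Algebra (ZMod 2) K]
    (k s : ℕ) (hk : Odd k) (hs : Odd s) (hks : Nat.Coprime k s)
    (hcard : Fintype.card K = 2 ^ (2 * k))
    (b : K) (hb : ∀ x : K, x ≠ 0 → ∃ m : ℕ, x = b ^ m)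
    (c : K) (hc : c ^ (2 ^ k) ≠ c)
    (hapn : IsAPN (fam k s b c))
    (r : ℕ) (hr : Nat.gcd r (2 * k) = 1)
    (g : K → K) (hg : g = fun x => x ^ (2 ^ r + 1))
    (hea : EAEquiv (fam k s b c) g) :
    code (fam k s b c) = code g := by
  have : CharP K 2 := charP_of_injective_algebraMap (algebraMap (ZMod 2) K).injective 2
  subst hg
  rcases eq_or_ne k 1 with rfl | hk1
  · have hcard4 : Fintype.card K = 4 := by simpa using hcard
    have hq (x : K) : x ^ 4 = x := hcard4 ▸ FiniteField.pow_card x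
    have hr_odd : Odd r := Nat.coprime_two_right.1 (by simpa using hr)
    have hgold : (fun x : K => x ^ (2 ^ r + 1)) = fun x => x ^ 3 := by
      funext x
      rw [pow_succ x (2 ^ r), pow_two_pow_of_odd hq hr_odd]
      ring
    rw [fam_eq_of_card_eq_four hcard4 hs, hgold]
    refine code_smul (fun x => x ^ 3) fun hd => hc ?_
    obtain rfl : b + b ^ 2 = c := CharTwo.add_eq_zero.1 hd
    linear_combination hq b + b ^ 3 * CharTwo.two_eq_zero (R := K)
  · exact absurd hea (not_eaEquiv_fam_gold hk hk1 hcard hc hr)
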